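/- arXiv:1507.05388 — 2 statements merged into one kernel-verified Lean document; each statement's English description precedes it below -/
import Mathlib

section
/- Let P be a program and M ⊆ at(P). Then M is an answer set of P if and only if M is a model of P and, for every m ∈ M, the program P_{M,m} has no models. -/
open Classical

noncomputable section

/-- A rule of a disjunctive logic program: head, positive body, negative body. -/
structure Rule (A : Type*) where
  head : Finset A
  bodyP : Finset A
  bodyN : Finset A
  deriving DecidableEq

/-- A program is a finite set of rules. -/
abbrev Program (A : Type*) := Finset (Rule A)

variable {A : Type*} [DecidableEq A]

/-- The atoms occurring in a program. -/
def atoms (P : Program A) : Finset A := P.sup (fun r => r.head ∪ r.bodyP ∪ r.bodyN)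

/-- An interpretation `I` satisfies a rule `r` iff `(H(r) ∪ B⁻(r)) ∩ I ≠ ∅` or `B⁺(r) \ I ≠ ∅`. -/
def satR (I : Set A) (r : Rule A) : Prop :=
  (∃ a ∈ r.head ∪ r.bodyN, a ∈ I) ∨ (∃ a ∈ r.bodyP, a ∉ I)

/-- `I` is a model of `P` iff it satisfies every rule of `P`. -/
def isModel (I : Set A) (P : Program A) : Prop := ∀ r ∈ P, satR I r

/-- The Gelfond-Lifschitz reduct `P^I`. -/
def reduct (P : Program A) (I : Set A) : Program A :=
  (P.filter (fun r => ∀ a ∈ r.bodyN, a ∉ I)).image (fun r => ⟨r.head, r.bodyP, ∅⟩)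

/-- `I` is an inclusion-minimal model of `P`. -/
def isMinModel (I : Set A) (P : Program A) : Prop :=
  isModel I P ∧ ∀ J ⊆ I, isModel J P → J = I

/-- `I` is an answer set of `P` iff `I` is a minimal model of the reduct `P^I`. -/
def isAnswerSet (I : Set A) (P : Program A) : Prop := isMinModel I (reduct P I)

/-- The collection of answer sets of `P`. -/
def AS (P : Program A) : Set (Set A) := {M | isAnswerSet M P}

/-- Dual-Horn: every rule has at most one positive body atom and empty negative body. -/
def dualHorn (P : Program A) : Prop := ∀ r ∈ P, r.bodyP.card ≤ 1 ∧ r.bodyN = ∅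

/-- Dual-normal: every rule is a constraint or has at most one positive body atom. -/
def dualNormal (P : Program A) : Prop := ∀ r ∈ P, r.head = ∅ ∨ r.bodyP.card ≤ 1

/-- Normal: every rule has at most one head atom. -/
def normal (P : Program A) : Prop := ∀ r ∈ P, r.head.card ≤ 1

/-- The proper rules (non-constraints) of `P`. -/
def properPart (P : Program A) : Program A := P.filter (fun r => r.head ≠ ∅)

/-- The constraints of `P`. -/
def constraintPart (P : Program A) : Program A := P.filter (fun r => r.head = ∅)

/-- `P[t]`: replace each rule with empty positive body by one whose positive body is `{t}`. -/
def progT (P : Program A) (t : A) : Program A :=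
  P.image (fun r => if r.bodyP = ∅ then ⟨r.head, {t}, r.bodyN⟩ else r)

/-- The elimination sets `E_i` computed from `P[t]` (for `P` dual-Horn). -/
def E (P : Program A) (t : A) : ℕ → Set A
  | 0 => ∅
  | (i+1) => {b | ∃ r ∈ progT P t, r.bodyP = {b} ∧ ↑r.head ⊆ E P t i}

/-- The program `P_{M,m}`. -/
def pmm (P : Program A) (M : Set A) (m : A) : Program A :=
  reduct (properPart P) M ∪
    ((atoms P).filter (fun b => b ∉ M)).image (fun b => ⟨∅, {b}, ∅⟩) ∪
    {⟨∅, {m}, ∅⟩}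

theorem isModel_reduct_iff (P : Program A) (I J : Set A) :
    isModel J (reduct P I) ↔ ∀ r ∈ P, (∀ a ∈ r.bodyN, a ∉ I) →
      (∃ a ∈ r.head, a ∈ J) ∨ (∃ a ∈ r.bodyP, a ∉ J) := by
  unfold isModel reduct satR
  constructor
  · intro h r hr hn
    have := h ⟨r.head, r.bodyP, ∅⟩
      (Finset.mem_image.2 ⟨r, Finset.mem_filter.2 ⟨hr, hn⟩, rfl⟩)
    simpa using this
  · intro h r hr
    obtain ⟨s, hs, rfl⟩ := Finset.mem_image.1 hr
    obtain ⟨h1, h2⟩ := Finset.mem_filter.1 hs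
    simpa using h s h1 h2

theorem isModel_pmm_iff (P : Program A) (M N : Set A) (m : A) :
    isModel N (pmm P M m) ↔ isModel N (reduct (properPart P) M) ∧
      (∀ b ∈ atoms P, b ∉ M → b ∉ N) ∧ m ∉ N := by
  constructor
  · intro h
    refine ⟨fun r hr => h r ?_, fun b hb hbM => ?_, ?_⟩
    · exact Finset.mem_union_left _ (Finset.mem_union_left _ hr)
    · have := h ⟨∅, {b}, ∅⟩ (Finset.mem_union_left _ (Finset.mem_union_right _
        (Finset.mem_image.2 ⟨b, Finset.mem_filter.2 ⟨hb, hbM⟩, rfl⟩)))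
      simpa [satR] using this
    · have := h ⟨∅, {m}, ∅⟩ (Finset.mem_union_right _ (Finset.mem_singleton.2 rfl))
      simpa [satR] using this
  · rintro ⟨h1, h2, h3⟩ r hr
    rcases Finset.mem_union.1 hr with hr | hr
    · rcases Finset.mem_union.1 hr with hr | hr
      · exact h1 r hr
      · obtain ⟨b, hb, rfl⟩ := Finset.mem_image.1 hr
        obtain ⟨hb1, hb2⟩ := Finset.mem_filter.1 hb
        simpa [satR] using h2 b hb1 hb2
    · rw [Finset.mem_singleton.1 hr]
      simpa [satR] using h3

theorem head_mem_atoms {P : Program A} {r : Rule A} (hr : r ∈ P) {a : A} (ha : a ∈ r.head) :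
    a ∈ atoms P := by
  have h : r.head ∪ r.bodyP ∪ r.bodyN ≤ atoms P :=
    Finset.le_sup (f := fun r : Rule A => r.head ∪ r.bodyP ∪ r.bodyN) hr
  exact h (by simp [ha])

theorem isModel_iff_reduct (P : Program A) (M : Set A) :
    isModel M P ↔ isModel M (reduct P M) := by
  rw [isModel_reduct_iff]
  unfold isModel satR
  refine forall₂_congr fun r _ => ?_
  simp only [Finset.mem_union]
  grind

theorem isModel_inter (P : Program A) (M N : Set A) (m : A) (hP : isModel M P)
    (hN : isModel N (pmm P M m)) : isModel (N ∩ M) (reduct P M) := by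
  rw [isModel_pmm_iff, isModel_reduct_iff] at hN
  rw [isModel_iff_reduct, isModel_reduct_iff] at hP
  rw [isModel_reduct_iff]
  obtain ⟨h1, h2, -⟩ := hN
  intro r hr hn
  by_cases he : r.head = ∅
  · rcases hP r hr hn with ⟨a, ha, -⟩ | ⟨a, ha, haM⟩
    · simp [he] at ha
    · exact Or.inr ⟨a, ha, fun h => haM h.2⟩
  · rcases h1 r (Finset.mem_filter.2 ⟨hr, he⟩) hn with ⟨a, ha, haN⟩ | ⟨a, ha, haN⟩
    · refine Or.inl ⟨a, ha, haN, ?_⟩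
      by_contra hc
      exact h2 a (head_mem_atoms hr ha) hc haN
    · exact Or.inr ⟨a, ha, fun h => haN h.1⟩

/-- `M ⊆ at(P)` is an answer set of `P` iff `M` is a model of `P` and,
for every `m ∈ M`, the program `P_{M,m}` has no models. -/
theorem answerSet_iff_pmm_no_models (P : Program A) (M : Set A) (hM : M ⊆ ↑(atoms P)) :
    isAnswerSet M P ↔
      (isModel M P ∧ ∀ m ∈ M, ¬ ∃ N : Set A, isModel N (pmm P M m)) := by
  constructor
  · rintro ⟨h1, h2⟩
    have hP := (isModel_iff_reduct P M).2 h1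
    refine ⟨hP, ?_⟩
    rintro m hm ⟨N, hN⟩
    have hJ := h2 (N ∩ M) Set.inter_subset_right (isModel_inter P M N m hP hN)
    have hmN : m ∈ N ∩ M := hJ.symm ▸ hm
    exact ((isModel_pmm_iff P M N m).1 hN).2.2 hmN.1
  · rintro ⟨hP, h⟩
    refine ⟨(isModel_iff_reduct P M).1 hP, fun J hJ hJm => ?_⟩
    refine Set.Subset.antisymm hJ fun m hm => ?_
    by_contra hc
    refine h m hm ⟨J, (isModel_pmm_iff P M J m).2 ⟨?_, fun b _ hb hbJ => hb (hJ hbJ), hc⟩⟩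
    rw [isModel_reduct_iff] at hJm ⊢
    exact fun r hr hn => hJm r (Finset.mem_filter.1 hr).1 hn
end
end

section
/- Let P be a dual-normal program and M ⊆ at(P). Then M is an answer set of P if and only if M is a model of P and, for every m ∈ M, the atom t_m belongs to ⋃_{i≥0} E_i, where the sets E_i are computed from the dual-Horn program P_{M,m} together with a fresh atom t_m (that is, from P_{M,m}[t_m]). -/
open Classical

noncomputable section

variable {A : Type*} [DecidableEq A]

theorem E_mono (Q : Program A) (t : A) : Monotone (E Q t) := by
  apply monotone_nat_of_le_succ
  intro n
  induction n with
  | zero => intro x hx; exact hx.elim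
  | succ n ih =>
    rintro x ⟨r, hr, hb, hh⟩
    exact ⟨r, hr, hb, hh.trans ih⟩

theorem finset_subset_E (Q : Program A) (t : A) (s : Finset A)
    (h : ∀ a ∈ s, ∃ i, a ∈ E Q t i) : ∃ i, (↑s : Set A) ⊆ E Q t i := by
  induction s using Finset.induction_on with
  | empty => exact ⟨0, by simp⟩
  | insert a s ha ih =>
    obtain ⟨i, hi⟩ := ih (fun b hb => h b (Finset.mem_insert_of_mem hb))
    obtain ⟨j, hj⟩ := h a (Finset.mem_insert_self _ _)
    refine ⟨max i j, ?_⟩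
    intro x hx
    rcases Finset.mem_insert.1 (Finset.mem_coe.1 hx) with rfl | hx
    · exact E_mono Q t (le_max_right i j) hj
    · exact E_mono Q t (le_max_left i j) (hi hx)

theorem mem_atoms_of {Q : Program A} {r : Rule A} (hr : r ∈ Q) {a : A}
    (ha : a ∈ r.head ∪ r.bodyP ∪ r.bodyN) : a ∈ atoms Q := by
  have : r.head ∪ r.bodyP ∪ r.bodyN ≤ atoms Q :=
    Finset.le_sup (f := fun r : Rule A => r.head ∪ r.bodyP ∪ r.bodyN) hr
  exact this ha

theorem E_sound {Q : Program A} {t : A} (hN : ∀ r ∈ Q, r.bodyN = ∅) (ht : t ∉ atoms Q)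
    {J : Set A} (hJ : isModel J Q) (i : ℕ) : ∀ b ∈ E Q t i, b ∉ J ∧ b ≠ t := by
  induction i with
  | zero => intro b hb; exact hb.elim
  | succ i ih =>
    rintro b ⟨r', hr', hb, hh⟩
    obtain ⟨r, hr, rfl⟩ := Finset.mem_image.1 hr'
    have hs := hJ r hr
    have hn := hN r hr
    by_cases he : r.bodyP = ∅
    · simp only [he, if_true] at hh
      rcases hs with ⟨a, ha, haJ⟩ | ⟨a, ha, haJ⟩
      · rw [hn, Finset.union_empty] at ha
        exact absurd haJ (ih a (hh ha)).1
      · simp [he] at ha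
    · simp only [he, if_false] at hh hb
      have hbt : b ∈ atoms Q := mem_atoms_of hr (by simp [hb])
      refine ⟨fun hbJ => ?_, fun h => ht (h ▸ hbt)⟩
      rcases hs with ⟨a, ha, haJ⟩ | ⟨a, ha, haJ⟩
      · rw [hn, Finset.union_empty] at ha
        exact absurd haJ (ih a (hh ha)).1
      · rw [hb, Finset.mem_singleton] at ha
        exact haJ (ha ▸ hbJ)

theorem E_complete {Q : Program A} {t : A} (hQ : dualHorn Q)
    (h : t ∉ ⋃ i, E Q t i) : isModel (⋃ i, E Q t i)ᶜ Q := by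
  intro r hr
  by_contra hs
  simp only [satR, not_or, not_exists, not_and, Set.mem_compl_iff, not_not] at hs
  obtain ⟨h1, h2⟩ := hs
  obtain ⟨i, hi⟩ := finset_subset_E Q t r.head
    (fun a ha => Set.mem_iUnion.1 (h1 a (Finset.mem_union_left _ ha)))
  have hm := Finset.mem_image_of_mem
    (fun r : Rule A => if r.bodyP = ∅ then (⟨r.head, {t}, r.bodyN⟩ : Rule A) else r) hr
  by_cases he : r.bodyP = ∅
  · simp only [he, if_true] at hm
    exact h (Set.mem_iUnion.2 ⟨i + 1, _, hm, rfl, hi⟩)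
  · have hc : r.bodyP.card = 1 :=
      le_antisymm (hQ r hr).1 (Finset.card_pos.2 (Finset.nonempty_iff_ne_empty.2 he))
    obtain ⟨b, hb⟩ := Finset.card_eq_one.1 hc
    simp only [he, if_false] at hm
    exact h2 b (by simp [hb]) (Set.mem_iUnion.2 ⟨i + 1, r, hm, hb, hi⟩)

theorem mem_pmm {P : Program A} {M : Set A} {m : A} {r : Rule A} :
    r ∈ pmm P M m ↔
      (∃ s ∈ P, s.head ≠ ∅ ∧ (∀ a ∈ s.bodyN, a ∉ M) ∧ r = ⟨s.head, s.bodyP, ∅⟩) ∨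
      (∃ b ∈ atoms P, b ∉ M ∧ r = ⟨∅, {b}, ∅⟩) ∨ r = ⟨∅, {m}, ∅⟩ := by
  simp only [pmm, reduct, properPart, Finset.mem_union, Finset.mem_image, Finset.mem_filter,
    Finset.mem_singleton, or_assoc, and_assoc, eq_comm (a := r)]

theorem mem_reduct {P : Program A} {M : Set A} {r : Rule A} :
    r ∈ reduct P M ↔ ∃ s ∈ P, (∀ a ∈ s.bodyN, a ∉ M) ∧ r = ⟨s.head, s.bodyP, ∅⟩ := by
  simp only [reduct, Finset.mem_image, Finset.mem_filter, and_assoc, eq_comm (a := r)]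

theorem pmm_dualHorn {P : Program A} (hP : dualNormal P) (M : Set A) (m : A) :
    dualHorn (pmm P M m) := by
  intro r hr
  rcases mem_pmm.1 hr with ⟨s, hs, hh, -, rfl⟩ | ⟨b, -, -, rfl⟩ | rfl
  · exact ⟨(hP s hs).resolve_left hh, rfl⟩
  · simp
  · simp

theorem isModel_reduct_self {P : Program A} {M : Set A} :
    isModel M (reduct P M) ↔ isModel M P := by
  constructor
  · intro h r hr
    by_cases hn : ∀ a ∈ r.bodyN, a ∉ M
    · rcases h _ (mem_reduct.2 ⟨r, hr, hn, rfl⟩) with ⟨a, ha, haM⟩ | h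
      · exact Or.inl ⟨a, by simp at ha; simp [ha], haM⟩
      · exact Or.inr h
    · push Not at hn
      obtain ⟨a, ha, haM⟩ := hn
      exact Or.inl ⟨a, Finset.mem_union_right _ ha, haM⟩
  · intro h r hr
    obtain ⟨s, hs, hn, rfl⟩ := mem_reduct.1 hr
    rcases h s hs with ⟨a, ha, haM⟩ | h
    · rcases Finset.mem_union.1 ha with ha | ha
      · exact Or.inl ⟨a, by simpa using ha, haM⟩
      · exact absurd haM (hn a ha)
    · exact Or.inr h

/-- For a dual-normal program `P` and `M ⊆ at(P)`, `M` is an answer set of `P`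
iff `M` is a model of `P` and for every `m ∈ M`, the fresh atom `t_m` belongs to
`⋃ᵢ E_i` computed from `P_{M,m}[t_m]`. -/
theorem dualNormal_answerSet_iff_E (P : Program A) (hP : dualNormal P)
    (M : Set A) (hM : M ⊆ ↑(atoms P)) (tm : A → A)
    (htm : ∀ m ∈ M, tm m ∉ atoms (pmm P M m)) :
    isAnswerSet M P ↔
      (isModel M P ∧ ∀ m ∈ M, tm m ∈ ⋃ i, E (pmm P M m) (tm m) i) := by
  unfold isAnswerSet isMinModel
  rw [isModel_reduct_self]
  refine and_congr_right fun hMP => ⟨fun hmin m hm => ?_, fun hE J hJM hJ => ?_⟩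
  · by_contra ht
    have hK := E_complete (pmm_dualHorn hP M m) ht
    set K := (⋃ i, E (pmm P M m) (tm m) i)ᶜ with hKdef
    have hmK : m ∉ K := by
      rcases hK _ (mem_pmm.2 (Or.inr (Or.inr rfl))) with ⟨a, ha, -⟩ | ⟨a, ha, haK⟩
      · simp at ha
      · simp only [Finset.mem_singleton] at ha
        exact ha ▸ haK
    have hKM : ∀ b ∈ atoms P, b ∈ K → b ∈ M := by
      intro b hb hbK
      by_contra hbM
      rcases hK _ (mem_pmm.2 (Or.inr (Or.inl ⟨b, hb, hbM, rfl⟩))) with ⟨a, ha, -⟩ | ⟨a, ha, haK⟩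
      · simp at ha
      · simp only [Finset.mem_singleton] at ha
        exact haK (ha ▸ hbK)
    have hmod : isModel (K ∩ M) (reduct P M) := by
      intro r hr
      obtain ⟨s, hs, hn, rfl⟩ := mem_reduct.1 hr
      by_cases hh : s.head = ∅
      · rcases isModel_reduct_self.2 hMP _ hr with ⟨a, ha, -⟩ | ⟨a, ha, haM⟩
        · simp [hh] at ha
        · exact Or.inr ⟨a, ha, fun h => haM h.2⟩
      · rcases hK _ (mem_pmm.2 (Or.inl ⟨s, hs, hh, hn, rfl⟩)) with ⟨a, ha, haK⟩ | ⟨a, ha, haK⟩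
        · have ha' : a ∈ s.head := by simpa using ha
          exact Or.inl ⟨a, ha, haK, hKM a (mem_atoms_of hs (by simp [ha'])) haK⟩
        · exact Or.inr ⟨a, ha, fun h => haK h.1⟩
    have heq := hmin _ Set.inter_subset_right hmod
    rw [← heq] at hm
    exact hmK hm.1
  · refine Set.Subset.antisymm hJM fun m hm => ?_
    by_contra hmJ
    have hJm : isModel J (pmm P M m) := by
      intro r hr
      rcases mem_pmm.1 hr with ⟨s, hs, -, hn, rfl⟩ | ⟨b, -, hbM, rfl⟩ | rfl
      · exact hJ _ (mem_reduct.2 ⟨s, hs, hn, rfl⟩)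
      · exact Or.inr ⟨b, by simp, fun h => hbM (hJM h)⟩
      · exact Or.inr ⟨m, by simp, hmJ⟩
    obtain ⟨i, hi⟩ := Set.mem_iUnion.1 (hE m hm)
    exact (E_sound (fun r hr => (pmm_dualHorn hP M m r hr).2) (htm m hm) hJm i _ hi).2 rfl
end
end
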